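/- Let 0 < α < 1. There exists a constant c > 0, depending only on α, with the following property. Let V be a nontrivial finite-dimensional complex inner product space, A : V → V a self-adjoint positive definite linear operator, τ > 0, N ≥ 1, and σ^1, …, σ^N ∈ V. Let e^0 = 0 and, for 1 ≤ n ≤ N, let e^n ∈ V solve ∂̄_τ^α e^n + A e^n = σ^n. Then for every 1 ≤ n ≤ N, t_n ‖e^n‖ ≤ c · τ Σ_{j=1}^n ( ‖A^{-1} σ^j‖ + (t_{n+1} - t_j)^{α/2 - 1} t_j ‖A^{-1/2} σ^j‖ ), where t_k = kτ. -/

import Mathlib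

open scoped ComplexInnerProductSpace

/-- The backward Euler convolution quadrature weights `b_ℓ^(α) = (-1)^ℓ binom(α, ℓ)`. -/
noncomputable def cqWeight (α : ℝ) (ℓ : ℕ) : ℝ :=
  (-1 : ℝ) ^ ℓ * (∏ i ∈ Finset.range ℓ, (α - i)) / (Nat.factorial ℓ)

/-- The backward Euler CQ approximation `∂̄_τ^α e^n = τ^{-α} Σ_{ℓ=0}^n b_ℓ^(α) e^{n-ℓ}`. -/
noncomputable def cqDeriv (α : ℝ) {V : Type} [AddCommGroup V] [Module ℝ V]
    (τ : ℝ) (e : ℕ → V) (n : ℕ) : V :=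
  τ ^ (-α) • ∑ ℓ ∈ Finset.range (n + 1), cqWeight α ℓ • e (n - ℓ)

/-- Fractional power `A^β` via the functional (spectral) calculus. -/
noncomputable def opRPow {V : Type} [NormedAddCommGroup V] [InnerProductSpace ℂ V]
    [FiniteDimensional ℂ V] (A : V →L[ℂ] V) (β : ℝ) : V →L[ℂ] V :=
  cfc (fun x : ℝ => x ^ β) A

/-- The power series of the resolvent `1 / ((1 - ξ)^α + μ)`. -/
noncomputable def cqResolvent (α μ : ℝ) : PowerSeries ℝ :=
  (PowerSeries.mk (cqWeight α) + PowerSeries.C μ)⁻¹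

theorem cqWeight_zero (α : ℝ) : cqWeight α 0 = 1 := by simp [cqWeight]

theorem cqWeight_succ (α : ℝ) (n : ℕ) :
    cqWeight α (n + 1) = cqWeight α n * ((n - α) / (n + 1)) := by
  have h : (n.factorial : ℝ) ≠ 0 := by positivity
  simp only [cqWeight, Finset.prod_range_succ, Nat.factorial_succ]
  push_cast
  field_simp
  ring

/-- Partial sums of the convolution quadrature weights. -/
noncomputable def cqPartial (α : ℝ) (n : ℕ) : ℝ := ∑ k ∈ Finset.range (n + 1), cqWeight α k

theorem cqWeight_succ_eq_partial (α : ℝ) (n : ℕ) :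
    cqWeight α (n + 1) = -(α / (n + 1)) * cqPartial α n := by
  induction n with
  | zero => simp [cqPartial, cqWeight_succ, cqWeight_zero]
  | succ n ih =>
    rw [cqPartial, Finset.sum_range_succ, ← cqPartial, cqWeight_succ α (n + 1), ih]
    push_cast
    field_simp
    ring

theorem cqPartial_succ (α : ℝ) (n : ℕ) :
    cqPartial α (n + 1) = (1 - α / (n + 1)) * cqPartial α n := by
  rw [cqPartial, Finset.sum_range_succ, ← cqPartial, cqWeight_succ_eq_partial]
  ring

theorem cqPartial_zero (α : ℝ) : cqPartial α 0 = 1 := by simp [cqPartial, cqWeight_zero]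

theorem cqPartial_pos {α : ℝ} (hα1 : α < 1) (n : ℕ) : 0 < cqPartial α n := by
  induction n with
  | zero => simp [cqPartial_zero]
  | succ n ih =>
    rw [cqPartial_succ]
    refine mul_pos ?_ ih
    rw [sub_pos, div_lt_one (by positivity)]
    linarith [(Nat.cast_nonneg n : (0 : ℝ) ≤ n)]

theorem cqPartial_succ_le {α : ℝ} (hα0 : 0 < α) (hα1 : α < 1) (n : ℕ) :
    cqPartial α (n + 1) ≤ cqPartial α n := by
  rw [cqPartial_succ]
  have h : 0 ≤ α / ((n : ℝ) + 1) := by positivity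
  nlinarith [cqPartial_pos hα1 n]

theorem cqPartial_add_logConvex {α μ : ℝ} (hα0 : 0 < α) (hα1 : α < 1) (hμ : 0 ≤ μ) (n : ℕ) :
    (cqPartial α (n + 1) + μ) ^ 2 ≤ (cqPartial α n + μ) * (cqPartial α (n + 2) + μ) := by
  have h0 := cqPartial_pos hα1 n
  have h1 := cqPartial_pos hα1 (n + 1)
  have e1 := cqPartial_succ α n
  have e2 := cqPartial_succ α (n + 1)
  have hle := cqPartial_succ_le hα0 hα1 n
  have hx : α / (((n + 1 : ℕ) : ℝ) + 1) ≤ α / ((n : ℝ) + 1) := by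
    push_cast; gcongr; linarith
  have hy : 0 ≤ α / (((n + 1 : ℕ) : ℝ) + 1) := by positivity
  have hx0 : 0 ≤ α / ((n : ℝ) + 1) := by positivity
  generalize α / (((n + 1 : ℕ) : ℝ) + 1) = y at *
  generalize α / ((n : ℝ) + 1) = x at *
  generalize cqPartial α (n + 1) = p at *
  generalize cqPartial α n = q at *
  have e3 : cqPartial α (n + 2) = (1 - y) * p := e2
  rw [e3]
  have a1 : 0 ≤ (x - y) * (p * q) := mul_nonneg (by linarith) (by positivity)
  have a2 : y * p ≤ x * q := by gcongr
  have a3 : 0 ≤ μ * (x * q - y * p) := mul_nonneg hμ (by linarith)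
  have hp : p ^ 2 = p * ((1 - x) * q) := by rw [← e1]; ring
  have hd : q - p = x * q := by rw [e1]; ring
  nlinarith

theorem cqPartial_succ_eq_sum (α : ℝ) (n : ℕ) :
    cqPartial α (n + 1) =
      (1 - α) / (n + 1) * ∑ k ∈ Finset.range (n + 1), cqPartial α k := by
  induction n with
  | zero => simp [cqPartial_succ, cqPartial_zero]
  | succ n ih =>
    have h1 : ((n : ℝ) + 1) ≠ 0 := by positivity
    have hs : (1 - α) * ∑ k ∈ Finset.range (n + 1), cqPartial α k
        = (n + 1) * cqPartial α (n + 1) := by rw [ih]; field_simp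
    rw [Finset.sum_range_succ, cqPartial_succ α (n + 1), div_mul_eq_mul_div, mul_add, hs]
    push_cast
    field_simp
    ring

theorem rpow_le_sum_cqPartial {α : ℝ} (hα0 : 0 < α) (hα1 : α < 1) (n : ℕ) :
    ((n : ℝ) + 1) ^ (1 - α) ≤ ∑ k ∈ Finset.range (n + 1), cqPartial α k := by
  induction n with
  | zero => simp [cqPartial_zero]
  | succ n ih =>
    have hn : (0 : ℝ) < (n : ℝ) + 1 := by positivity
    rw [Finset.sum_range_succ, cqPartial_succ_eq_sum]
    have hb : (1 + 1 / ((n : ℝ) + 1)) ^ (1 - α) ≤ 1 + (1 - α) * (1 / ((n : ℝ) + 1)) :=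
      rpow_one_add_le_one_add_mul_self (by linarith [one_div_pos.2 hn]) (by linarith) (by linarith)
    have hfac : (((n + 1 : ℕ) : ℝ) + 1) = ((n : ℝ) + 1) * (1 + 1 / ((n : ℝ) + 1)) := by
      push_cast; field_simp
    rw [hfac, Real.mul_rpow (by positivity) (by positivity)]
    calc _ ≤ (∑ k ∈ Finset.range (n + 1), cqPartial α k) *
          (1 + (1 - α) * (1 / ((n : ℝ) + 1))) :=
          mul_le_mul ih hb (by positivity) (le_trans (by positivity) ih)
      _ = _ := by ring

section Renewal

variable {a g : ℕ → ℝ}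

/-- If the convolution of `g` with a positive nonincreasing sequence is constant one, then `g` is
nonnegative. -/
theorem nonneg_of_convolution_eq_one (ha : ∀ n, 0 < a n) (hmono : ∀ n, a (n + 1) ≤ a n)
    (hg : ∀ n, ∑ k ∈ Finset.range (n + 1), a (n - k) * g k = 1) (n : ℕ) : 0 ≤ g n := by
  induction n using Nat.strong_induction_on with
  | _ n ih =>
    rcases n with _ | n
    · have h := hg 0
      simp only [zero_add, Finset.sum_range_one, Nat.sub_self] at h
      by_contra hc
      nlinarith [ha 0]
    · have h := hg (n + 1)
      rw [Finset.sum_range_succ, ← hg n, Nat.sub_self] at h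
      have hle : ∑ k ∈ Finset.range (n + 1), a (n + 1 - k) * g k
          ≤ ∑ k ∈ Finset.range (n + 1), a (n - k) * g k := by
        refine Finset.sum_le_sum fun k hk => ?_
        have hk' : k < n + 1 := Finset.mem_range.1 hk
        have : n + 1 - k = (n - k) + 1 := by omega
        rw [this]
        exact mul_le_mul_of_nonneg_right (hmono _) (ih k hk')
      by_contra hc
      nlinarith [ha 0]

/-- Kaluza's theorem: if `a` is positive and log-convex then the reciprocal power series has
nonpositive coefficients beyond the constant one. -/
theorem kaluza_nonpos {d : ℕ → ℝ} (ha : ∀ n, 0 < a n)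
    (hlog : ∀ n, a (n + 1) ^ 2 ≤ a n * a (n + 2)) (hd0 : 0 ≤ d 0)
    (hd : ∀ n, ∑ k ∈ Finset.range (n + 2), a (n + 1 - k) * d k = 0) (n : ℕ) :
    d (n + 1) ≤ 0 := by
  have hr : Monotone fun n => a (n + 1) / a n := by
    refine monotone_nat_of_le_succ fun n => ?_
    rw [div_le_div_iff₀ (ha _) (ha _)]
    have := hlog n
    rw [pow_two] at this
    rw [mul_comm (a (n + 1 + 1))]
    exact this
  induction n using Nat.strong_induction_on with
  | _ n ih =>
    rcases n with _ | n
    · have h := hd 0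
      simp only [zero_add, Finset.sum_range_succ, Finset.sum_range_zero, Nat.sub_zero,
        Nat.sub_self] at h
      by_contra hc
      nlinarith [ha 0, mul_nonneg (ha 1).le hd0]
    · have h := hd (n + 1)
      have h' := hd n
      rw [Finset.sum_range_succ, Nat.sub_self] at h
      have key : 0 ≤ ∑ k ∈ Finset.range (n + 2), a (n + 1 + 1 - k) * d k := by
        have e : ∑ k ∈ Finset.range (n + 2), a (n + 1 + 1 - k) * d k
            = ∑ k ∈ Finset.range (n + 2), (a (n + 1 + 1 - k)
              - a (n + 1 + 1) / a (n + 1) * a (n + 1 - k)) * d k := by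
          simp only [sub_mul, Finset.sum_sub_distrib, mul_assoc, ← Finset.mul_sum, h']
          simp
        rw [e]
        refine Finset.sum_nonneg fun k hk => ?_
        have hk' : k < n + 2 := Finset.mem_range.1 hk
        rcases k with _ | k
        · simp [div_mul_cancel₀ _ (ha (n + 1)).ne']
        · refine mul_nonneg_of_nonpos_of_nonpos ?_ (ih k (by omega))
          have hm : a (n - k + 1) / a (n - k) ≤ a (n + 1 + 1) / a (n + 1) :=
            hr (show n - k ≤ n + 1 by omega)
          rw [div_le_iff₀ (ha _)] at hm
          have i1 : n + 1 + 1 - (k + 1) = n - k + 1 := by omega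
          have i2 : n + 1 - (k + 1) = n - k := by omega
          rw [i1, i2]
          linarith
      by_contra hc
      nlinarith [ha 0]

theorem antitone_of_convolution_eq_one (ha : ∀ n, 0 < a n)
    (hlog : ∀ n, a (n + 1) ^ 2 ≤ a n * a (n + 2))
    (hg : ∀ n, ∑ k ∈ Finset.range (n + 1), a (n - k) * g k = 1) : Antitone g := by
  refine antitone_nat_of_succ_le fun n => ?_
  let d : ℕ → ℝ := fun k => Nat.casesOn k (g 0) fun m => g (m + 1) - g m
  have h : d (n + 1) ≤ 0 := by
    refine kaluza_nonpos ha hlog ?_ (fun m => ?_) n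
    · have h := hg 0
      simp only [zero_add, Finset.sum_range_one, Nat.sub_self] at h
      change 0 ≤ g 0
      by_contra hc
      nlinarith [ha 0]
    · have h1 := hg (m + 1)
      have h0 := hg m
      rw [Finset.sum_range_succ'] at h1 ⊢
      simp only [Nat.add_sub_add_right] at h1 ⊢
      change ∑ k ∈ Finset.range (m + 1), a (m - k) * (g (k + 1) - g k) + a (m + 1 - 0) * g 0 = 0
      simp only [mul_sub, Finset.sum_sub_distrib]
      linarith
  exact sub_nonpos.1 h

theorem mul_sum_le_one_of_convolution_eq_one (ha : ∀ n, 0 < a n)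
    (hlog : ∀ n, a (n + 1) ^ 2 ≤ a n * a (n + 2))
    (hg : ∀ n, ∑ k ∈ Finset.range (n + 1), a (n - k) * g k = 1) (n : ℕ) :
    g n * ∑ k ∈ Finset.range (n + 1), a k ≤ 1 := by
  rw [← hg n, ← Finset.sum_range_reflect, Finset.mul_sum]
  refine Finset.sum_le_sum fun k hk => ?_
  have hk' : k ≤ n := Nat.lt_succ_iff.1 (Finset.mem_range.1 hk)
  rw [mul_comm, show n + 1 - 1 - k = n - k by omega]
  exact mul_le_mul_of_nonneg_left (antitone_of_convolution_eq_one ha hlog hg hk') (ha _).le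

end Renewal

theorem cqResolvent_mul {α μ : ℝ} (hμ : 0 ≤ μ) :
    cqResolvent α μ * (PowerSeries.mk (cqWeight α) + PowerSeries.C μ) = 1 := by
  refine PowerSeries.inv_mul_cancel _ ?_
  simp only [map_add, PowerSeries.constantCoeff_mk, PowerSeries.constantCoeff_C, cqWeight_zero]
  positivity

theorem cqResolvent_convolution {α μ : ℝ} (hμ : 0 ≤ μ) (n : ℕ) :
    ∑ k ∈ Finset.range (n + 1),
      (cqPartial α (n - k) + μ) * PowerSeries.coeff k (cqResolvent α μ) = 1 := by
  have hP : PowerSeries.mk (fun n => cqPartial α n + μ)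
      = (PowerSeries.mk (cqWeight α) + PowerSeries.C μ) * PowerSeries.mk 1 := by
    ext m
    rw [add_mul, map_add, PowerSeries.coeff_mk, PowerSeries.coeff_C_mul, PowerSeries.coeff_mul,
      Finset.Nat.sum_antidiagonal_eq_sum_range_succ_mk]
    simp [cqPartial]
  have h : cqResolvent α μ * PowerSeries.mk (fun n => cqPartial α n + μ) = PowerSeries.mk 1 := by
    rw [hP, ← mul_assoc, cqResolvent_mul hμ, one_mul]
  have := congrArg (PowerSeries.coeff n) h
  rw [PowerSeries.coeff_mul, Finset.Nat.sum_antidiagonal_eq_sum_range_succ_mk] at this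
  simpa [mul_comm] using this

theorem cqResolvent_coeff_nonneg {α μ : ℝ} (hα0 : 0 < α) (hα1 : α < 1) (hμ : 0 ≤ μ) (n : ℕ) :
    0 ≤ PowerSeries.coeff n (cqResolvent α μ) :=
  nonneg_of_convolution_eq_one (a := fun n => cqPartial α n + μ)
    (fun n => add_pos_of_pos_of_nonneg (cqPartial_pos hα1 n) hμ)
    (fun n => by simpa using cqPartial_succ_le hα0 hα1 n) (cqResolvent_convolution hμ) n

theorem cqResolvent_coeff_mul_le {α μ : ℝ} (hα0 : 0 < α) (hα1 : α < 1) (hμ : 0 ≤ μ) (n : ℕ) :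
    PowerSeries.coeff n (cqResolvent α μ) * (((n : ℝ) + 1) ^ (1 - α) + (n + 1) * μ) ≤ 1 := by
  have h := mul_sum_le_one_of_convolution_eq_one (a := fun n => cqPartial α n + μ)
    (fun n => add_pos_of_pos_of_nonneg (cqPartial_pos hα1 n) hμ)
    (cqPartial_add_logConvex hα0 hα1 hμ) (cqResolvent_convolution hμ) n
  refine le_trans (mul_le_mul_of_nonneg_left ?_ (cqResolvent_coeff_nonneg hα0 hα1 hμ n)) h
  rw [Finset.sum_add_distrib]
  simpa using rpow_le_sum_cqPartial hα0 hα1 n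

theorem mul_cqResolvent_coeff_le_inv {α τ l : ℝ} (hα0 : 0 < α) (hα1 : α < 1) (hτ : 0 < τ)
    (hl : 0 < l) (m : ℕ) :
    m * (τ ^ α * PowerSeries.coeff m (cqResolvent α (l * τ ^ α))) ≤ l ^ (-1 : ℝ) := by
  have hT : 0 < τ ^ α := Real.rpow_pos_of_pos hτ α
  have hμ : 0 ≤ l * τ ^ α := by positivity
  have hg := cqResolvent_coeff_nonneg hα0 hα1 hμ m
  have h := cqResolvent_coeff_mul_le hα0 hα1 hμ m
  rw [Real.rpow_neg_one, ← one_div, le_div_iff₀ hl]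
  have h1 : 0 ≤ ((m : ℝ) + 1) ^ (1 - α) := by positivity
  refine le_trans ?_ h
  have h2 := mul_nonneg hg h1
  have h3 := mul_nonneg hg hμ
  linarith

theorem cqResolvent_coeff_le_rpow {α τ l : ℝ} (hα0 : 0 < α) (hα1 : α < 1) (hτ : 0 < τ)
    (hl : 0 < l) (m : ℕ) :
    τ ^ α * PowerSeries.coeff m (cqResolvent α (l * τ ^ α))
      ≤ τ * ((((m : ℝ) + 1) * τ) ^ (α / 2 - 1) * l ^ (-(1 / 2) : ℝ)) := by
  have hT : 0 < τ ^ α := Real.rpow_pos_of_pos hτ α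
  have hμ : 0 ≤ l * τ ^ α := by positivity
  have hg := cqResolvent_coeff_nonneg hα0 hα1 hμ m
  have h := cqResolvent_coeff_mul_le hα0 hα1 hμ m
  have hm : (0 : ℝ) < (m : ℝ) + 1 := by positivity
  generalize PowerSeries.coeff m (cqResolvent α (l * τ ^ α)) = g at *
  generalize (m : ℝ) + 1 = M at *
  have hM : 0 < M ^ (1 - α) := Real.rpow_pos_of_pos hm _
  have h1 : g * M ^ (1 - α) ≤ 1 := by nlinarith [mul_nonneg hg (mul_nonneg hm.le hμ)]
  have h2 : g * (M * (l * τ ^ α)) ≤ 1 := by nlinarith [mul_nonneg hg hM.le]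
  have h12 : (g * M ^ (1 - α)) * (g * (M * (l * τ ^ α))) ≤ 1 :=
    mul_le_one₀ h1 (by positivity) h2
  refine (sq_le_sq₀ (by positivity) (by positivity)).1 ?_
  have hR : (τ * ((M * τ) ^ (α / 2 - 1) * l ^ (-(1 / 2) : ℝ))) ^ 2
      = τ ^ α * (M ^ (1 - α) * M * l)⁻¹ := by
    have e1 : (τ ^ (α / 2 - 1)) ^ 2 * τ ^ 2 = τ ^ α := by
      rw [← mul_pow, ← Real.rpow_add_one hτ.ne', ← Real.rpow_natCast, ← Real.rpow_mul hτ.le]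
      congr 1; push_cast; ring
    have e2 : (M ^ (α / 2 - 1)) ^ 2 = (M ^ (1 - α) * M)⁻¹ := by
      rw [← Real.rpow_add_one hm.ne', ← Real.rpow_natCast, ← Real.rpow_mul hm.le,
        ← Real.rpow_neg hm.le]
      congr 1; push_cast; ring
    have e3 : (l ^ (-(1 / 2) : ℝ)) ^ 2 = l⁻¹ := by
      rw [← Real.rpow_natCast, ← Real.rpow_mul hl.le, ← Real.rpow_neg_one]
      congr 1; push_cast; ring
    rw [Real.mul_rpow hm.le hτ.le, mul_pow, mul_pow, mul_pow, e2, e3, ← e1, mul_inv _ l]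
    ring
  rw [hR, ← div_eq_mul_inv, le_div_iff₀ (by positivity)]
  nlinarith

theorem eq_sum_cqResolvent {α τ l : ℝ} (hτ : 0 < τ) (hl : 0 ≤ l) {z s : ℕ → ℂ} {N : ℕ}
    (hz : z 0 = 0)
    (h : ∀ n, 1 ≤ n → n ≤ N → ((τ ^ (-α) : ℝ) : ℂ) *
      ∑ k ∈ Finset.range (n + 1), (cqWeight α k : ℂ) * z (n - k) + l * z n = s n)
    {n : ℕ} (hn : n ≤ N) :
    z n = ∑ j ∈ Finset.Icc 1 n,
      ((τ ^ α * PowerSeries.coeff (n - j) (cqResolvent α (l * τ ^ α)) : ℝ) : ℂ) * s j := by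
  have hT : 0 < τ ^ α := Real.rpow_pos_of_pos hτ α
  have hμ : 0 ≤ l * τ ^ α := by positivity
  set G := PowerSeries.map Complex.ofRealHom (cqResolvent α (l * τ ^ α)) with hG
  set H := PowerSeries.map Complex.ofRealHom
    (PowerSeries.mk (cqWeight α) + PowerSeries.C (l * τ ^ α)) with hH
  have hGH : G * H = 1 := by rw [hG, hH, ← map_mul, cqResolvent_mul hμ, map_one]
  have hZ : PowerSeries.mk z = H * PowerSeries.mk z * G := by
    rw [mul_comm, ← mul_assoc, hGH, one_mul]
  have hS : ∀ m, PowerSeries.coeff m (H * PowerSeries.mk z)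
      = ∑ k ∈ Finset.range (m + 1), (cqWeight α k : ℂ) * z (m - k) + (l * τ ^ α : ℝ) * z m := by
    intro m
    rw [hH, map_add, PowerSeries.map_C, add_mul, map_add, PowerSeries.coeff_C_mul,
      PowerSeries.coeff_mul, Finset.Nat.sum_antidiagonal_eq_sum_range_succ_mk]
    simp
  have hzn := congrArg (PowerSeries.coeff n) hZ
  rw [PowerSeries.coeff_mk, PowerSeries.coeff_mul,
    Finset.Nat.sum_antidiagonal_eq_sum_range_succ_mk] at hzn
  rw [hzn, Finset.sum_range_succ', Finset.range_eq_Ico,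
    Finset.sum_Ico_add' (fun k => PowerSeries.coeff k (H * PowerSeries.mk z) *
      PowerSeries.coeff (n - k) G) 0 n 1]
  have h0 : PowerSeries.coeff 0 (H * PowerSeries.mk z) = 0 := by simp [hS, hz]
  simp only [h0, zero_mul, add_zero, zero_add]
  refine Finset.sum_congr (by ext; simp) fun j hj => ?_
  rw [Finset.mem_Icc] at hj
  have hTc : ((τ ^ (-α) : ℝ) : ℂ) * ((τ ^ α : ℝ) : ℂ) = 1 := by
    rw [← Complex.ofReal_mul, ← Real.rpow_add hτ]; simp
  have hc : PowerSeries.coeff (n - j) G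
      = ((PowerSeries.coeff (n - j) (cqResolvent α (l * τ ^ α)) : ℝ) : ℂ) := by
    simp [hG]
  rw [hS, ← h j hj.1 (hj.2.trans hn), hc]
  rw [Complex.ofReal_mul, Complex.ofReal_mul]
  linear_combination (-((PowerSeries.coeff (n - j) (cqResolvent α (l * τ ^ α)) : ℝ) : ℂ) *
    ∑ k ∈ Finset.range (j + 1), (cqWeight α k : ℂ) * z (j - k)) * hTc

section Spectral

variable {V : Type} [NormedAddCommGroup V] [InnerProductSpace ℂ V]

theorem aeval_apply_of_apply_eq_smul {A : V →L[ℂ] V} {l : ℝ} {v : V} (hv : A v = (l : ℂ) • v)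
    (p : Polynomial ℝ) : Polynomial.aeval A p v = ((p.eval l : ℝ) : ℂ) • v := by
  have hpow : ∀ n : ℕ, (A ^ n) v = ((l ^ n : ℝ) : ℂ) • v := by
    intro n
    induction n with
    | zero => simp
    | succ n ih =>
      rw [pow_succ', mul_apply_eq_comp, ih, map_smul, hv, smul_smul]
      push_cast
      rw [pow_succ]
  induction p using Polynomial.induction_on' with
  | add p q hp hq => simp [hp, hq, add_smul]
  | monomial n a =>
    rw [Polynomial.aeval_monomial, Polynomial.eval_monomial, mul_apply_eq_comp, hpow,
      Algebra.algebraMap_eq_smul_one]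
    simp [mul_smul, smul_comm a]

variable [FiniteDimensional ℂ V]

theorem finite_real_spectrum (A : V →L[ℂ] V) : (spectrum ℝ A).Finite := by
  rw [← spectrum.preimage_algebraMap ℂ]
  refine Set.Finite.preimage (RCLike.ofReal_injective (K := ℂ)).injOn ?_
  have h := Module.End.finite_spectrum (A : V →ₗ[ℂ] V)
  refine h.subset fun z hz hu => hz ?_
  have := hu.map (Module.End.toContinuousLinearMap V)
  rw [map_sub] at this
  exact this

theorem cfc_apply_of_apply_eq_smul {A : V →L[ℂ] V} (hA : IsSelfAdjoint A) (f : ℝ → ℝ) {l : ℝ}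
    {v : V} (hv : A v = (l : ℂ) • v) : cfc f A v = ((f l : ℝ) : ℂ) • v := by
  classical
  set S := insert l (finite_real_spectrum A).toFinset with hS
  set p := Lagrange.interpolate S id f with hp
  have hpe : ∀ x ∈ S, p.eval x = f x := fun x hx =>
    Lagrange.eval_interpolate_at_node f Function.injective_id.injOn hx
  have hcfc : cfc f A = Polynomial.aeval A p := by
    rw [← cfc_polynomial p A hA]
    exact cfc_congr fun x hx => (hpe x (by simp [hS, hx])).symm
  rw [hcfc, aeval_apply_of_apply_eq_smul hv, hpe l (by simp [hS])]

theorem inner_cfc_of_apply_eq_smul {A : V →L[ℂ] V} (hA : IsSelfAdjoint A) (f : ℝ → ℝ) {l : ℝ}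
    {v : V} (hv : A v = (l : ℂ) • v) (x : V) : ⟪v, cfc f A x⟫ = (f l : ℂ) * ⟪v, x⟫ := by
  have hs : IsSelfAdjoint (cfc f A) := IsSelfAdjoint.cfc
  rw [← ContinuousLinearMap.isSelfAdjoint_iff_isSymmetric.1 hs |>.apply_clm,
    cfc_apply_of_apply_eq_smul hA f hv, inner_smul_left, Complex.conj_ofReal]

end Spectral

theorem inner_cqDeriv {V : Type} [NormedAddCommGroup V] [InnerProductSpace ℂ V] (α τ : ℝ)
    (e : ℕ → V) (n : ℕ) (v : V) :
    ⟪v, cqDeriv α τ e n⟫ = ((τ ^ (-α) : ℝ) : ℂ) *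
      ∑ k ∈ Finset.range (n + 1), (cqWeight α k : ℂ) * ⟪v, e (n - k)⟫ := by
  simp only [cqDeriv, ← Complex.coe_smul, inner_smul_right, inner_sum]

section Coordinates

variable {ι V : Type*} [Fintype ι] [NormedAddCommGroup V] [InnerProductSpace ℂ V]

/-- The operator that is diagonal in the orthonormal basis `b` with entries `k`. -/
noncomputable def orthoDiag (b : OrthonormalBasis ι ℂ V) (k : ι → ℝ) (x : V) : V :=
  ∑ i, ((k i : ℂ) * ⟪b i, x⟫) • b i

theorem inner_orthoDiag (b : OrthonormalBasis ι ℂ V) (k : ι → ℝ) (x : V) (i : ι) :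
    ⟪b i, orthoDiag b k x⟫ = (k i : ℂ) * ⟪b i, x⟫ :=
  b.orthonormal.inner_right_fintype _ i

theorem norm_le_mul_norm_of_inner (b : OrthonormalBasis ι ℂ V) {C : ℝ} (hC : 0 ≤ C) {x y : V}
    (h : ∀ i, ‖⟪b i, x⟫‖ ≤ C * ‖⟪b i, y⟫‖) : ‖x‖ ≤ C * ‖y‖ := by
  refine (sq_le_sq₀ (by positivity) (by positivity)).1 ?_
  rw [mul_pow, ← b.sum_sq_norm_inner_right x, ← b.sum_sq_norm_inner_right y, Finset.mul_sum]
  refine Finset.sum_le_sum fun i _ => ?_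
  rw [← mul_pow]
  exact pow_le_pow_left₀ (norm_nonneg _) (h i) 2

theorem norm_orthoDiag_le (b : OrthonormalBasis ι ℂ V) {C : ℝ} (hC : 0 ≤ C) {k w : ι → ℝ}
    (hk : ∀ i, 0 ≤ k i) (hkw : ∀ i, k i ≤ C * w i) {x y : V}
    (hy : ∀ i, ⟪b i, y⟫ = (w i : ℂ) * ⟪b i, x⟫) : ‖orthoDiag b k x‖ ≤ C * ‖y‖ := by
  refine norm_le_mul_norm_of_inner b hC fun i => ?_
  rw [inner_orthoDiag, hy, norm_mul, norm_mul, Complex.norm_real, Complex.norm_real, ← mul_assoc,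
    Real.norm_of_nonneg (hk i)]
  exact mul_le_mul_of_nonneg_right
    ((hkw i).trans (mul_le_mul_of_nonneg_left (le_abs_self _) hC)) (norm_nonneg _)

end Coordinates

/-- A weighted estimate with weight `t_n` for the backward Euler CQ scheme. -/
theorem weighted_estimate_tn (α : ℝ) (hα0 : 0 < α) (hα1 : α < 1) :
    ∃ c : ℝ, 0 < c ∧
      ∀ (V : Type) (_ : NormedAddCommGroup V) (_ : InnerProductSpace ℂ V)
        (_ : FiniteDimensional ℂ V) (_ : Nontrivial V)
        (A : V →L[ℂ] V), IsSelfAdjoint A →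
        (∀ x : V, x ≠ 0 → 0 < (⟪A x, x⟫).re) →
        ∀ τ : ℝ, 0 < τ → ∀ N : ℕ, 1 ≤ N → ∀ (σ e : ℕ → V), e 0 = 0 →
        (∀ n : ℕ, 1 ≤ n → n ≤ N → cqDeriv α τ e n + A (e n) = σ n) →
        ∀ n : ℕ, 1 ≤ n → n ≤ N →
          ((n : ℝ) * τ) * ‖e n‖
          ≤ c * τ * ∑ j ∈ Finset.Icc 1 n,
              (‖opRPow A (-1) (σ j)‖
                + (((n : ℝ) + 1) * τ - (j : ℝ) * τ) ^ (α / 2 - 1) * ((j : ℝ) * τ)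
                  * ‖opRPow A (-(1 / 2)) (σ j)‖) := by
  refine ⟨1, one_pos, ?_⟩
  intro V _ _ _ _ A hA hpos τ hτ N _ σ e he0 he n hn1 hnN
  have hsym := ContinuousLinearMap.isSelfAdjoint_iff_isSymmetric.1 hA
  let b := hsym.eigenvectorBasis rfl
  let l := hsym.eigenvalues rfl
  have hb : ∀ i, A (b i) = (l i : ℂ) • b i := fun i => hsym.apply_eigenvectorBasis rfl i
  have hl : ∀ i, 0 < l i := by
    intro i
    have h := hpos (b i) (b.orthonormal.ne_zero i)
    rw [hb i, inner_smul_left, inner_self_eq_norm_sq_to_K, b.norm_eq_one] at h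
    simpa using h
  have hop : ∀ (β : ℝ) (x : V) i, ⟪b i, opRPow A β x⟫ = ((l i ^ β : ℝ) : ℂ) * ⟪b i, x⟫ :=
    fun β x i => inner_cfc_of_apply_eq_smul hA _ (hb i) x
  let K : ℕ → Fin _ → ℝ := fun m i =>
    τ ^ α * PowerSeries.coeff m (cqResolvent α (l i * τ ^ α))
  have hT : 0 < τ ^ α := Real.rpow_pos_of_pos hτ α
  have hK : ∀ m i, 0 ≤ K m i := fun m i =>
    mul_nonneg hT.le (cqResolvent_coeff_nonneg hα0 hα1 (mul_nonneg (hl i).le hT.le) m)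
  have hrep : (((n * τ : ℝ)) : ℂ) • e n = ∑ j ∈ Finset.Icc 1 n,
      (orthoDiag b (fun i => τ * (((n - j : ℕ) : ℝ) * K (n - j) i)) (σ j)
        + orthoDiag b (fun i => j * τ * K (n - j) i) (σ j)) := by
    refine b.repr.injective (PiLp.ext fun i => ?_)
    rw [b.repr_apply_apply, b.repr_apply_apply, inner_smul_right, inner_sum]
    have hz := eq_sum_cqResolvent (α := α) (z := fun m => ⟪b i, e m⟫)
      (s := fun m => ⟪b i, σ m⟫) hτ (hl i).le (by simp [he0])
      (fun m h1 h2 => by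
        rw [← he m h1 h2, inner_add_right, inner_cqDeriv, ← hsym.apply_clm (b i), hb i,
          inner_smul_left, Complex.conj_ofReal]) hnN
    rw [hz, Finset.mul_sum]
    refine Finset.sum_congr rfl fun j hj => ?_
    rw [inner_add_right, inner_orthoDiag, inner_orthoDiag, ← add_mul, ← mul_assoc,
      ← Complex.ofReal_add, ← Complex.ofReal_mul, Nat.cast_sub (Finset.mem_Icc.1 hj).2]
    congr 2
    simp only [K]
    ring
  have hnorm : n * τ * ‖e n‖ = ‖(((n * τ : ℝ)) : ℂ) • e n‖ := by
    rw [norm_smul, Complex.norm_real, Real.norm_of_nonneg (by positivity)]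
  rw [hnorm, hrep, one_mul, Finset.mul_sum]
  refine norm_sum_le_of_le _ fun j hj => (norm_add_le _ _).trans ?_
  have hjn := (Finset.mem_Icc.1 hj).2
  have hcast : ((n : ℝ) + 1) * τ - j * τ = (((n - j : ℕ) : ℝ) + 1) * τ := by
    rw [Nat.cast_sub hjn]; ring
  rw [hcast, mul_add, ← mul_assoc τ]
  refine add_le_add ?_ ?_
  · exact norm_orthoDiag_le b hτ.le
      (fun i => mul_nonneg hτ.le (mul_nonneg (Nat.cast_nonneg _) (hK _ i)))
      (fun i => mul_le_mul_of_nonneg_left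
        (mul_cqResolvent_coeff_le_inv hα0 hα1 hτ (hl i) _) hτ.le) (hop _ _)
  · refine norm_orthoDiag_le b (by positivity)
      (fun i => mul_nonneg (by positivity) (hK _ i)) (fun i => ?_) (hop _ _)
    refine (mul_le_mul_of_nonneg_left
      (cqResolvent_coeff_le_rpow hα0 hα1 hτ (hl i) (n - j)) (by positivity)).trans_eq ?_
    ring
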